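/- arXiv:2503.09544 — 2 statements merged into one kernel-verified Lean document; each statement's English description precedes it below -/
import Mathlib

section
/- Let n,m ∈ ℕ, γ ∈ [0,1/2), and let f : {0,1}^n × {0,1}^n → {0,1}^m reproduce the uniform distribution over {0,1}^m. Then for all d_A, d_B ∈ ℕ, every unit vector ψ ∈ (ℂ²)^{⊗m} ⊗ ℂ^{d_A} ⊗ ℂ^{d_B}, and every family of POVMs {A^{xy}_a}_{a∈{0,1}^m} on ℂ^{d_A} and {B^{xy}_a}_{a∈{0,1}^m} on ℂ^{d_B} indexed by (x,y) ∈ {0,1}^n × {0,1}^n, one has 2^{−2n} · Σ_{x,y∈{0,1}^n} Σ_{a∈{0,1}^m} ⟨ψ, (M^{f(x,y)}_a ⊗ Σ_{a' : d_H(a,a') ≤ γm} A^{xy}_{a'} ⊗ B^{xy}_{a'}) ψ⟩ ≤ (λ_γ)^m. -/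
open Matrix Kronecker Finset
open scoped ComplexOrder

noncomputable section

/-- Bit strings of length `n`. -/
abbrev Bits (n : ℕ) := Fin n → Bool

/-- Binary entropy function `h(p) = -p log₂ p - (1-p) log₂ (1-p)` (with `h 0 = 0`). -/
def binEnt (p : ℝ) : ℝ := -(p * Real.logb 2 p) - (1 - p) * Real.logb 2 (1 - p)

/-- `λ_γ = 2^{h(γ)} (1/2 + 1/(2√2))`. -/
def lamGamma (γ : ℝ) : ℝ := (2 : ℝ) ^ binEnt γ * (1 / 2 + 1 / (2 * Real.sqrt 2))

/-- Standard basis vector `|a⟩` of `ℂ²`. -/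
def ket (a : Bool) : Bool → ℂ := fun j => if j = a then 1 else 0

/-- The vector `H^z |a⟩` of `ℂ²`, where `H` is the 2×2 Hadamard matrix. -/
def hadVec (z a : Bool) : Bool → ℂ :=
  if z then fun j => (if j && a then (-1 : ℂ) else 1) / (Real.sqrt 2 : ℂ) else ket a

/-- The unit vector `⊗_{i} H^{z_i}|a_i⟩` of `(ℂ²)^{⊗ m}`. -/
def bb84Vec {m : ℕ} (z a : Bits m) : Bits m → ℂ := fun j => ∏ i, hadVec (z i) (a i) (j i)

/-- `M^z_a`: the rank-one orthogonal projector onto `⊗_i H^{z_i}|a_i⟩`. -/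
def Mproj {m : ℕ} (z a : Bits m) : Matrix (Bits m) (Bits m) ℂ :=
  vecMulVec (bb84Vec z a) (star (bb84Vec z a))

/-- A POVM: a family of positive semidefinite matrices summing to the identity. -/
def IsPOVM {d : Type*} [Fintype d] [DecidableEq d] {ι : Type*} [Fintype ι]
    (A : ι → Matrix d d ℂ) : Prop :=
  (∀ a, (A a).PosSemidef) ∧ ∑ a, A a = 1

open scoped InnerProductSpace ComplexConjugate

theorem IsSelfAdjoint.inner_apply_comm {E : Type*} [NormedAddCommGroup E]
    [InnerProductSpace ℂ E] [CompleteSpace E] {T : E →L[ℂ] E} (hT : IsSelfAdjoint T) (x y : E) :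
    ⟪T x, y⟫_ℂ = ⟪x, T y⟫_ℂ := hT.isSymmetric x y

theorem inner_self_eq_ofReal_norm_sq {E : Type*} [NormedAddCommGroup E] [InnerProductSpace ℂ E]
    (x : E) : ⟪x, x⟫_ℂ = (‖x‖ : ℂ) ^ 2 := inner_self_eq_norm_sq_to_K (𝕜 := ℂ) x

/-- A family of self-adjoint operators whose squares sum to the identity preserves the total
squared norm. -/
theorem sum_norm_sq_apply {ι E : Type*} [Fintype ι] [NormedAddCommGroup E]
    [InnerProductSpace ℂ E] [CompleteSpace E] {P : ι → E →L[ℂ] E}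
    (hP : ∀ a, IsSelfAdjoint (P a)) (hP1 : ∑ a, P a * P a = 1) (x : E) :
    ∑ a, ‖P a x‖ ^ 2 = ‖x‖ ^ 2 := by
  have h : ∀ a, ‖P a x‖ ^ 2 = (⟪x, (P a * P a) x⟫_ℂ).re := fun a => by
    rw [mul_apply_eq_comp, ← (hP a).inner_apply_comm, inner_self_eq_ofReal_norm_sq]
    norm_cast
  simp_rw [h]
  rw [← Complex.re_sum, ← inner_sum, ← _root_.sum_apply, hP1]
  exact (norm_sq_eq_re_inner (𝕜 := ℂ) x).symm

theorem norm_inner_le_half_add {E : Type*} [NormedAddCommGroup E] [InnerProductSpace ℂ E]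
    (x y : E) : ‖⟪x, y⟫_ℂ‖ ≤ (‖x‖ ^ 2 + ‖y‖ ^ 2) / 2 := by
  nlinarith [norm_inner_le_norm (𝕜 := ℂ) x y, sq_nonneg (‖x‖ - ‖y‖)]

/-- Almost-orthogonality of two measurements: if the overlaps `G a b` are bounded by `c`, then so
is the overlap of the images of the two measurement isometries. -/
theorem norm_sum_overlap_le {ι E : Type*} [Fintype ι] [NormedAddCommGroup E]
    [InnerProductSpace ℂ E] [CompleteSpace E] {P Q P' Q' : ι → E →L[ℂ] E}
    (hP : ∀ a, IsSelfAdjoint (P a)) (hP1 : ∑ a, P a * P a = 1)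
    (hQ : ∀ a, IsSelfAdjoint (Q a)) (hQ1 : ∑ a, Q a * Q a = 1)
    (hP' : ∀ a, IsSelfAdjoint (P' a)) (hP1' : ∑ a, P' a * P' a = 1)
    (hQ' : ∀ a, IsSelfAdjoint (Q' a)) (hQ1' : ∑ a, Q' a * Q' a = 1)
    (hPQ : ∀ a b, Commute (P a) (Q b)) (hPQ' : ∀ a b, Commute (P a) (Q' b))
    (G : ι → ι → ℂ) (c : ℝ) (hc : 0 ≤ c) (hG : ∀ a b, ‖G a b‖ ≤ c) (u u' : ι → E) :
    ‖∑ a, ∑ b, G a b * ⟪Q a (P a (u a)), Q' b (P' b (u' b))⟫_ℂ‖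
      ≤ c * ((∑ a, ‖u a‖ ^ 2 + ∑ b, ‖u' b‖ ^ 2) / 2) := by
  have hle : ∀ {R : ι → E →L[ℂ] E}, (∀ a, IsSelfAdjoint (R a)) → ∑ a, R a * R a = 1 →
      ∀ a x, ‖R a x‖ ^ 2 ≤ ‖x‖ ^ 2 := fun {R} h h1 a x =>
    (single_le_sum (f := fun a => ‖R a x‖ ^ 2) (fun _ _ => by positivity) (mem_univ a)).trans_eq
      (sum_norm_sq_apply h h1 x)
  have hswap : ∀ a b, ⟪Q a (P a (u a)), Q' b (P' b (u' b))⟫_ℂ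
      = ⟪Q' b (Q a (u a)), P a (P' b (u' b))⟫_ℂ := fun a b => by
    have h1 : Q a (P a (u a)) = P a (Q a (u a)) := (DFunLike.congr_fun (hPQ a a).eq (u a)).symm
    have h2 : P a (Q' b (P' b (u' b))) = Q' b (P a (P' b (u' b))) :=
      DFunLike.congr_fun (hPQ' a b).eq (P' b (u' b))
    rw [h1, (hP a).inner_apply_comm, h2, ← (hQ' b).inner_apply_comm]
  calc ‖∑ a, ∑ b, G a b * ⟪Q a (P a (u a)), Q' b (P' b (u' b))⟫_ℂ‖
      ≤ ∑ a, ∑ b, c * ((‖Q' b (Q a (u a))‖ ^ 2 + ‖P a (P' b (u' b))‖ ^ 2) / 2) := by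
        refine (norm_sum_le _ _).trans (sum_le_sum fun a _ => (norm_sum_le _ _).trans
          (sum_le_sum fun b _ => ?_))
        rw [norm_mul, hswap]
        exact mul_le_mul (hG a b) (norm_inner_le_half_add _ _) (norm_nonneg _) hc
    _ = c * ((∑ a, ∑ b, ‖Q' b (Q a (u a))‖ ^ 2 + ∑ b, ∑ a, ‖P a (P' b (u' b))‖ ^ 2) / 2) := by
        rw [sum_comm (f := fun b a => ‖P a (P' b (u' b))‖ ^ 2)]
        simp_rw [← sum_add_distrib, sum_div, mul_sum]
    _ ≤ c * ((∑ a, ‖u a‖ ^ 2 + ∑ b, ‖u' b‖ ^ 2) / 2) := by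
        simp_rw [sum_norm_sq_apply hQ' hQ1', sum_norm_sq_apply hP hP1]
        exact mul_le_mul_of_nonneg_left (div_le_div_of_nonneg_right (add_le_add
          (sum_le_sum fun a _ => hle hQ hQ1 a _) (sum_le_sum fun b _ => hle hP' hP1' b _))
          zero_le_two) hc

/-- Operator form of the monogamy game bound, by a Schur test. -/
theorem sum_guess_le {ζ ι κ E : Type*} [Fintype ζ] [Fintype ι] [Fintype κ]
    [NormedAddCommGroup E] [InnerProductSpace ℂ E] [CompleteSpace E]
    {P Q : ζ → ι → E →L[ℂ] E}
    (hP : ∀ z a, IsSelfAdjoint (P z a)) (hP1 : ∀ z, ∑ a, P z a * P z a = 1)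
    (hQ : ∀ z a, IsSelfAdjoint (Q z a)) (hQ1 : ∀ z, ∑ a, Q z a * Q z a = 1)
    (hPQ : ∀ z a z' b, Commute (P z a) (Q z' b))
    (β : ζ → ι → κ → ℂ) (c : ζ → ζ → ℝ) (hc : ∀ z z', 0 ≤ c z z')
    (hcs : ∀ z z', c z z' = c z' z)
    (hβ : ∀ z z' a b, ‖∑ j, conj (β z a j) * β z' b j‖ ≤ c z z')
    (C : ℝ) (hC0 : 0 ≤ C) (hC : ∀ z, ∑ z', c z z' ≤ C)
    (ψ : κ → E) (hψ : ∑ j, ‖ψ j‖ ^ 2 = 1) :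
    ∑ z, ∑ a, ‖P z a (Q z a (∑ j, conj (β z a j) • ψ j))‖ ^ 2 ≤ C := by
  set u : ζ → ι → E := fun z a => P z a (Q z a (∑ j, conj (β z a j) • ψ j)) with hu
  set s : ζ → ℝ := fun z => ∑ a, ‖u z a‖ ^ 2 with hs
  have hs0 : ∀ z, 0 ≤ s z := fun z => by positivity
  set w : ζ → κ → E := fun z j => ∑ a, β z a j • Q z a (P z a (u z a)) with hw
  have hsw : ∀ z, (s z : ℂ) = ∑ j, ⟪ψ j, w z j⟫_ℂ := fun z => by
    simp only [hw, inner_sum, inner_smul_right, hs]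
    rw [sum_comm]
    push_cast
    refine sum_congr rfl fun a _ => ?_
    have : ∑ j, β z a j * ⟪ψ j, Q z a (P z a (u z a))⟫_ℂ
        = ⟪∑ j, conj (β z a j) • ψ j, Q z a (P z a (u z a))⟫_ℂ := by
      rw [sum_inner]
      simp_rw [inner_smul_left, Complex.conj_conj]
    rw [this, ← (hQ z a).inner_apply_comm, ← (hP z a).inner_apply_comm]
    exact (inner_self_eq_ofReal_norm_sq (u z a)).symm
  have hS : (∑ z, s z) ≤ ∑ j, ‖ψ j‖ * ‖∑ z, w z j‖ := by
    have h1 : ((∑ z, s z : ℝ) : ℂ) = ∑ j, ⟪ψ j, ∑ z, w z j⟫_ℂ := by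
      push_cast
      simp_rw [hsw, inner_sum]
      exact sum_comm
    have h2 : ‖((∑ z, s z : ℝ) : ℂ)‖ = ∑ z, s z := by
      rw [Complex.norm_real, Real.norm_of_nonneg (sum_nonneg fun z _ => hs0 z)]
    rw [← h2, h1]
    exact (norm_sum_le _ _).trans (sum_le_sum fun j _ => norm_inner_le_norm _ _)
  have hpair : ∀ z z', ‖∑ j, ⟪w z j, w z' j⟫_ℂ‖ ≤ c z z' * ((s z + s z') / 2) := fun z z' => by
    have : ∑ j, ⟪w z j, w z' j⟫_ℂ = ∑ a, ∑ b, (∑ j, conj (β z a j) * β z' b j)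
        * ⟪Q z a (P z a (u z a)), Q z' b (P z' b (u z' b))⟫_ℂ := by
      simp only [hw, inner_sum, sum_inner, inner_smul_left, inner_smul_right, sum_mul]
      simp only [mul_sum]
      refine (sum_congr rfl fun _ _ => sum_comm).trans ?_
      rw [sum_comm]
      refine sum_congr rfl fun a _ => ?_
      rw [sum_comm]
      exact sum_congr rfl fun b _ => sum_congr rfl fun j _ => by ring
    rw [this]
    exact norm_sum_overlap_le (hP z) (hP1 z) (hQ z) (hQ1 z) (hP z') (hP1 z') (hQ z') (hQ1 z')
      (fun a b => hPQ z a z b) (fun a b => hPQ z a z' b) _ _ (hc z z') (hβ z z') _ _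
  have hW : ∑ j, ‖∑ z, w z j‖ ^ 2 ≤ C * ∑ z, s z := by
    have h1 : ((∑ j, ‖∑ z, w z j‖ ^ 2 : ℝ) : ℂ) = ∑ z, ∑ z', ∑ j, ⟪w z j, w z' j⟫_ℂ := by
      push_cast
      have : ∀ j, ((‖∑ z, w z j‖ : ℂ)) ^ 2 = ∑ z, ∑ z', ⟪w z j, w z' j⟫_ℂ := fun j => by
        rw [← inner_self_eq_ofReal_norm_sq, sum_inner]
        simp_rw [inner_sum]
      simp_rw [this]
      rw [sum_comm]
      exact sum_congr rfl fun z _ => sum_comm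
    have h2 : ‖((∑ j, ‖∑ z, w z j‖ ^ 2 : ℝ) : ℂ)‖ = ∑ j, ‖∑ z, w z j‖ ^ 2 := by
      rw [Complex.norm_real, Real.norm_of_nonneg (sum_nonneg fun z _ => by positivity)]
    rw [← h2, h1]
    calc _ ≤ ∑ z, ∑ z', c z z' * ((s z + s z') / 2) :=
          (norm_sum_le _ _).trans (sum_le_sum fun z _ => (norm_sum_le _ _).trans
            (sum_le_sum fun z' _ => hpair z z'))
      _ = ∑ z, (∑ z', c z z') * s z := by
          have h3 : ∑ z, ∑ z', c z z' * s z' = ∑ z, ∑ z', c z z' * s z := by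
            rw [sum_comm]
            exact sum_congr rfl fun z _ => sum_congr rfl fun z' _ => by rw [hcs]
          have h4 : ∑ z, ∑ z', c z z' * ((s z + s z') / 2)
              = (∑ z, ∑ z', c z z' * s z + ∑ z, ∑ z', c z z' * s z') / 2 := by
            simp_rw [← sum_add_distrib, sum_div]
            exact sum_congr rfl fun z _ => sum_congr rfl fun z' _ => by ring
          rw [h4, h3]
          simp_rw [sum_mul]
          ring
      _ ≤ C * ∑ z, s z := by
          rw [mul_sum]
          exact sum_le_sum fun z _ => mul_le_mul_of_nonneg_right (hC z) (hs0 z)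
  have hCS := sum_mul_sq_le_sq_mul_sq univ (fun j => ‖ψ j‖) (fun j => ‖∑ z, w z j‖)
  rw [hψ, one_mul] at hCS
  have hS0 : 0 ≤ ∑ z, s z := sum_nonneg fun z _ => hs0 z
  have hsq : (∑ z, s z) ^ 2 ≤ C * ∑ z, s z :=
    (pow_le_pow_left₀ hS0 hS 2).trans (hCS.trans hW)
  change ∑ z, s z ≤ C
  rcases hS0.eq_or_lt with h | h
  · exact h ▸ hC0
  · nlinarith

/-- Overlap bound for the bases selected by two bit strings. -/
def overlapBound {m : ℕ} (z z' : Bits m) : ℝ := ∏ i, if z i = z' i then 1 else 1 / √2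

theorem norm_hadVec_overlap_le (z z' a b : Bool) :
    ‖∑ j, conj (hadVec z a j) * hadVec z' b j‖ ≤ if z = z' then 1 else 1 / √2 := by
  have h2 : (√2 : ℂ)⁻¹ * (√2 : ℂ)⁻¹ = 1 / 2 := by
    rw [← mul_inv, ← Complex.ofReal_mul, Real.mul_self_sqrt zero_le_two, one_div,
      Complex.ofReal_ofNat]
  cases z <;> cases z' <;> cases a <;> cases b <;>
    simp [hadVec, ket, neg_div, abs_of_nonneg, h2]
  norm_num

theorem norm_bb84Vec_overlap_le {m : ℕ} (z z' a b : Bits m) :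
    ‖∑ j, conj (bb84Vec z a j) * bb84Vec z' b j‖ ≤ overlapBound z z' := by
  have h : ∑ j, conj (bb84Vec z a j) * bb84Vec z' b j
      = ∏ i, ∑ j, conj (hadVec (z i) (a i) j) * hadVec (z' i) (b i) j := by
    rw [Fintype.prod_sum]
    simp [bb84Vec, prod_mul_distrib]
  rw [h, norm_prod]
  exact prod_le_prod (fun _ _ => norm_nonneg _) fun i _ => norm_hadVec_overlap_le _ _ _ _

theorem sum_overlapBound {m : ℕ} (z : Bits m) : ∑ z', overlapBound z z' = (1 + 1 / √2) ^ m := by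
  have h : ∑ z' : Bits m, overlapBound z z'
      = ∏ i, ∑ b : Bool, if z i = b then 1 else 1 / √2 := by
    rw [Fintype.prod_sum]
    rfl
  have h1 : ∀ i, (∑ b : Bool, if z i = b then 1 else 1 / √2) = 1 + 1 / √2 := fun i => by
    cases z i <;> simp [add_comm]
  rw [h]
  simp_rw [h1]
  simp

/-- A positive semidefinite matrix has a Hermitian square root. -/
theorem Matrix.PosSemidef.exists_hermitian_sqrt {d : Type*} [Fintype d] [DecidableEq d]
    {A : Matrix d d ℂ} (hA : A.PosSemidef) : ∃ S : Matrix d d ℂ, S.IsHermitian ∧ S * S = A := by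
  open scoped MatrixOrder in
  exact ⟨CFC.sqrt A, (CFC.sqrt_nonneg A).posSemidef.isHermitian,
    CFC.sqrt_mul_sqrt_self A hA.nonneg⟩

theorem re_dotProduct_Mproj_kronecker {m : ℕ} {D : Type*} [Fintype D] [DecidableEq D] (z a : Bits m)
    (S : Matrix D D ℂ) (ψ : Bits m × D → ℂ) :
    (star ψ ⬝ᵥ ((Mproj z a ⊗ₖ (Sᴴ * S)).mulVec ψ)).re
      = ‖toEuclideanCLM (𝕜 := ℂ) S
          (∑ j, conj (bb84Vec z a j) • WithLp.toLp 2 fun p => ψ (j, p))‖ ^ 2 := by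
  set φ : D → ℂ := fun p => ∑ j, conj (bb84Vec z a j) * ψ (j, p) with hφ
  have h1 : (∑ j, conj (bb84Vec z a j) • WithLp.toLp 2 fun p => ψ (j, p))
      = WithLp.toLp 2 φ := by
    ext p
    simp [hφ]
  have h2 : star ψ ⬝ᵥ ((Mproj z a ⊗ₖ (Sᴴ * S)).mulVec ψ)
      = star φ ⬝ᵥ ((Sᴴ * S).mulVec φ) := by
    simp only [dotProduct, mulVec, Fintype.sum_prod_type, kronecker_apply, Mproj, vecMulVec_apply,
      hφ, Pi.star_apply, star_sum, sum_mul, mul_sum, star_mul']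
    rw [sum_comm]
    refine sum_congr rfl fun p _ => ?_
    refine (sum_congr rfl fun _ _ => sum_comm).trans ?_
    rw [sum_comm]
    refine sum_congr rfl fun q _ => ?_
    rw [sum_comm]
    refine sum_congr rfl fun j' _ => sum_congr rfl fun j _ => ?_
    simp only [RCLike.star_def, Complex.conj_conj]
    ring
  rw [h1, h2, toEuclideanCLM_toLp, ← mulVec_mulVec, dotProduct_mulVec, ← star_mulVec,
    EuclideanSpace.norm_sq_eq]
  simp only [dotProduct, Complex.re_sum, Pi.star_apply, RCLike.star_def,
    ← Complex.normSq_eq_conj_mul_self, Complex.normSq_eq_norm_sq, Complex.ofReal_re]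

theorem sum_game_le {m dA dB : ℕ} (ψ : Bits m × Fin dA × Fin dB → ℂ)
    (hψ : ∑ i, ‖ψ i‖ ^ 2 = 1)
    (A : Bits m → Bits m → Matrix (Fin dA) (Fin dA) ℂ)
    (B : Bits m → Bits m → Matrix (Fin dB) (Fin dB) ℂ)
    (hA : ∀ z, IsPOVM (A z)) (hB : ∀ z, IsPOVM (B z)) :
    ∑ z, ∑ a, (star ψ ⬝ᵥ ((Mproj z a ⊗ₖ (A z a ⊗ₖ B z a)).mulVec ψ)).re
      ≤ (1 + 1 / √2) ^ m := by
  choose S hS hSA using fun z a => ((hA z).1 a).exists_hermitian_sqrt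
  choose T hT hTB using fun z a => ((hB z).1 a).exists_hermitian_sqrt
  let Φ := toEuclideanCLM (n := Fin dA × Fin dB) (𝕜 := ℂ)
  have key := sum_guess_le (P := fun z a => Φ (S z a ⊗ₖ 1)) (Q := fun z a => Φ (1 ⊗ₖ T z a))
    (fun z a => IsSelfAdjoint.map (by
      rw [IsSelfAdjoint, star_eq_conjTranspose, conjTranspose_kronecker, (hS z a).eq,
        conjTranspose_one]) Φ)
    (fun z => by
      simp_rw [← map_mul, ← mul_kronecker_mul, hSA, ← map_sum]
      rw [← map_one Φ, ← one_kronecker_one, ← (hA z).2, mul_one]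
      congr 1
      ext i j
      simp [Matrix.sum_apply, sum_mul])
    (fun z a => IsSelfAdjoint.map (by
      rw [IsSelfAdjoint, star_eq_conjTranspose, conjTranspose_kronecker, (hT z a).eq,
        conjTranspose_one]) Φ)
    (fun z => by
      simp_rw [← map_mul, ← mul_kronecker_mul, hTB, ← map_sum]
      rw [← map_one Φ, ← one_kronecker_one, ← (hB z).2, mul_one]
      congr 1
      ext i j
      simp [Matrix.sum_apply, mul_sum])
    (fun z a z' b => Commute.map (by
      rw [Commute, SemiconjBy, ← mul_kronecker_mul, ← mul_kronecker_mul]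
      simp) Φ)
    bb84Vec overlapBound (fun z z' => prod_nonneg fun i _ => by split_ifs <;> positivity)
    (fun z z' => prod_congr rfl fun i _ => by simp only [eq_comm]) norm_bb84Vec_overlap_le
    ((1 + 1 / √2) ^ m) (by positivity) (fun z => (sum_overlapBound z).le)
    (fun j => WithLp.toLp 2 fun p => ψ (j, p))
    (by
      rw [← hψ, Fintype.sum_prod_type]
      simp_rw [EuclideanSpace.norm_sq_eq])
  refine le_trans (le_of_eq (sum_congr rfl fun z _ => sum_congr rfl fun a _ => ?_)) key
  have hfac : A z a ⊗ₖ B z a = (S z a ⊗ₖ T z a)ᴴ * (S z a ⊗ₖ T z a) := by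
    rw [conjTranspose_kronecker, (hS z a).eq, (hT z a).eq, ← mul_kronecker_mul, hSA, hTB]
  rw [hfac, re_dotProduct_Mproj_kronecker, ← mul_apply_eq_comp, ← map_mul, ← mul_kronecker_mul,
    mul_one, one_mul]

/-- Entropy bound on the volume of a Hamming ball. -/
theorem card_hammingBall_le {m : ℕ} {γ : ℝ} (hγ0 : 0 ≤ γ) (hγ1 : γ < 1 / 2) :
    ((univ.filter fun k : Bits m => ((univ.filter fun i => k i = true).card : ℝ) ≤ γ * m).card : ℝ)
      ≤ ((2 : ℝ) ^ binEnt γ) ^ m := by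
  rcases hγ0.eq_or_lt with rfl | hγ
  · have : (univ.filter fun k : Bits m =>
        ((univ.filter fun i => k i = true).card : ℝ) ≤ 0 * m) ⊆ {fun _ => false} := by
      intro k hk
      simpa [filter_eq_empty_iff, funext_iff] using hk
    simpa [binEnt] using card_le_card this
  have hγ' : 0 < 1 - γ := by linarith
  have hent : (2 : ℝ) ^ binEnt γ * (γ ^ γ * (1 - γ) ^ (1 - γ)) = 1 := by
    have e1 : γ ^ γ = (2 : ℝ) ^ (γ * Real.logb 2 γ) := by
      rw [mul_comm, Real.rpow_mul zero_le_two, Real.rpow_logb two_pos (by norm_num) hγ]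
    have e2 : (1 - γ) ^ (1 - γ) = (2 : ℝ) ^ ((1 - γ) * Real.logb 2 (1 - γ)) := by
      rw [mul_comm, Real.rpow_mul zero_le_two, Real.rpow_logb two_pos (by norm_num) hγ']
    rw [e1, e2, ← Real.rpow_add two_pos, ← Real.rpow_add two_pos, binEnt]
    ring_nf
    simp
  set t : ℝ := γ ^ γ * (1 - γ) ^ (1 - γ) with ht
  have ht0 : 0 < t := by positivity
  set K := univ.filter fun k : Bits m => ((univ.filter fun i => k i = true).card : ℝ) ≤ γ * m
  set p : Bits m → ℝ := fun k => ∏ i, if k i = true then γ else 1 - γ with hp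
  have hp1 : ∑ k, p k = 1 := by
    have : ∑ k, p k = ∏ _i : Fin m, ∑ b : Bool, if b = true then γ else 1 - γ := by
      rw [Fintype.prod_sum]
    rw [this]
    simp
  have hpK : ∀ k ∈ K, t ^ m ≤ p k := fun k hk => by
    have hk : ((univ.filter fun i => k i = true).card : ℝ) ≤ γ * m := (mem_filter.1 hk).2
    set c : ℕ := (univ.filter fun i => k i = true).card with hc
    have hcm : (c : ℝ) + ((univ.filter fun i => ¬ k i = true).card : ℝ) = m := by
      have := card_filter_add_card_filter_not (s := (univ : Finset (Fin m))) (fun i => k i = true)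
      rw [card_univ, Fintype.card_fin] at this
      exact_mod_cast this
    have hpk : p k = γ ^ (c : ℝ) * (1 - γ) ^ ((m : ℝ) - c) := by
      simp only [hp]
      rw [prod_ite, prod_const, prod_const, ← hcm, add_sub_cancel_left, Real.rpow_natCast,
        Real.rpow_natCast]
    have htm : t ^ m = γ ^ (γ * m) * (1 - γ) ^ ((m : ℝ) - γ * m) := by
      rw [ht, mul_pow, ← Real.rpow_natCast, ← Real.rpow_natCast, ← Real.rpow_mul hγ.le,
        ← Real.rpow_mul hγ'.le, sub_mul, one_mul]
    have e : (m : ℝ) - c = ((m : ℝ) - γ * m) + (γ * m - c) := by ring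
    have e' : γ * m = c + (γ * m - c) := by ring
    rw [hpk, htm, e, Real.rpow_add hγ']
    nth_rewrite 1 [e']
    rw [Real.rpow_add hγ]
    have : γ ^ (γ * m - c) ≤ (1 - γ) ^ (γ * m - c) :=
      Real.rpow_le_rpow hγ.le (by linarith) (by linarith)
    have h1 : 0 ≤ γ ^ (c : ℝ) := by positivity
    have h2 : 0 ≤ (1 - γ) ^ ((m : ℝ) - γ * m) := by positivity
    calc _ = γ ^ (c : ℝ) * (1 - γ) ^ ((m : ℝ) - γ * m) * γ ^ (γ * m - c) := by ring
      _ ≤ γ ^ (c : ℝ) * (1 - γ) ^ ((m : ℝ) - γ * m) * (1 - γ) ^ (γ * m - c) := by gcongr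
      _ = _ := by ring
  have hK : (K.card : ℝ) * t ^ m ≤ 1 := by
    calc (K.card : ℝ) * t ^ m = ∑ _k ∈ K, t ^ m := by simp
      _ ≤ ∑ k ∈ K, p k := sum_le_sum hpK
      _ ≤ ∑ k, p k := sum_le_sum_of_subset_of_nonneg (subset_univ _) fun k _ _ =>
          prod_nonneg fun i _ => by split_ifs <;> positivity
      _ = 1 := hp1
  have : ((2 : ℝ) ^ binEnt γ) ^ m * t ^ m = 1 := by rw [← mul_pow, hent, one_pow]
  exact le_of_mul_le_mul_right (hK.trans_eq this.symm) (by positivity)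

/-- Averages over a fibration with equal fibres are at most the average of fibrewise values at a
suitable section. -/
theorem exists_section_sum_le {α ζ : Type*} [Fintype α] [Fintype ζ] [DecidableEq ζ] (f : α → ζ)
    (N : ℝ) (hN : 0 < N) (hf : ∀ z, ((univ.filter fun p => f p = z).card : ℝ) = N)
    (g : α → ℝ) : ∃ s : ζ → α, (∀ z, f (s z) = z) ∧ ∑ p, g p ≤ N * ∑ z, g (s z) := by
  have hne : ∀ z, (univ.filter fun p => f p = z).Nonempty := fun z => by
    rw [← card_pos, ← Nat.cast_pos (α := ℝ), hf z]
    exact hN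
  choose s hs hmax using fun z => exists_max_image _ g (hne z)
  refine ⟨s, fun z => (mem_filter.1 (hs z)).2, ?_⟩
  rw [← sum_fiberwise univ f g, mul_sum]
  refine sum_le_sum fun z _ => ?_
  rw [← hf z, ← nsmul_eq_mul]
  exact sum_le_card_nsmul _ _ _ (hmax z)

/-- Reindexing a sum over a Hamming ball by the error pattern. -/
theorem sum_hammingBall_eq {m : ℕ} {M : Type*} [AddCommMonoid M] (r : ℝ) (a : Bits m)
    (F : Bits m → M) :
    ∑ a' ∈ univ.filter (fun a' : Bits m => (hammingDist a a' : ℝ) ≤ r), F a'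
      = ∑ k ∈ univ.filter (fun k : Bits m => ((univ.filter fun i => k i = true).card : ℝ) ≤ r),
          F (fun i => xor (a i) (k i)) := by
  have hxor : ∀ x y : Bool, (x = (x ^^ y)) ↔ y = false := by decide
  refine sum_nbij' (fun a' i => xor (a i) (a' i)) (fun k i => xor (a i) (k i)) ?_ ?_ ?_ ?_ ?_ <;>
    simp [hammingDist, hxor]

theorem kronecker_sum_right {l k p q ι : Type*} (s : Finset ι) (X : Matrix l k ℂ)
    (Y : ι → Matrix p q ℂ) : X ⊗ₖ (∑ i ∈ s, Y i) = ∑ i ∈ s, X ⊗ₖ Y i := by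
  ext ⟨i, j⟩ ⟨i', j'⟩
  simp [Matrix.sum_apply, mul_sum]

/-- monogamy-of-entanglement bound for functions reproducing the uniform
distribution (adapted Lemma `w_FS` / Corollary for fixed states). -/
theorem stmt0 (n m : ℕ) (γ : ℝ) (hγ0 : 0 ≤ γ) (hγ1 : γ < 1 / 2)
    (f : Bits n × Bits n → Bits m)
    (hf : ∀ z : Bits m,
      ((Finset.univ.filter (fun p : Bits n × Bits n => f p = z)).card : ℝ) / 2 ^ (2 * n)
        = 1 / 2 ^ m)
    (dA dB : ℕ)
    (ψ : Bits m × Fin dA × Fin dB → ℂ) (hψ : ∑ i, ‖ψ i‖ ^ 2 = 1)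
    (A : Bits n → Bits n → Bits m → Matrix (Fin dA) (Fin dA) ℂ)
    (B : Bits n → Bits n → Bits m → Matrix (Fin dB) (Fin dB) ℂ)
    (hA : ∀ x y, IsPOVM (A x y)) (hB : ∀ x y, IsPOVM (B x y)) :
    (1 / 2 ^ (2 * n) : ℝ) * ∑ x : Bits n, ∑ y : Bits n, ∑ a : Bits m,
      (star ψ ⬝ᵥ ((Mproj (f (x, y)) a ⊗ₖ
          (∑ a' ∈ Finset.univ.filter
              (fun a' : Bits m => (hammingDist a a' : ℝ) ≤ γ * m),
            A x y a' ⊗ₖ B x y a')).mulVec ψ)).re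
      ≤ lamGamma γ ^ m := by
  set R := univ.filter fun k : Bits m => ((univ.filter fun i => k i = true).card : ℝ) ≤ γ * m
  set g : Bits n × Bits n → ℝ := fun p => ∑ k ∈ R, ∑ a : Bits m,
    (star ψ ⬝ᵥ ((Mproj (f p) a ⊗ₖ (A p.1 p.2 (fun i => xor (a i) (k i))
      ⊗ₖ B p.1 p.2 (fun i => xor (a i) (k i)))).mulVec ψ)).re with hg
  have hsum : ∑ x : Bits n, ∑ y : Bits n, ∑ a : Bits m,
      (star ψ ⬝ᵥ ((Mproj (f (x, y)) a ⊗ₖ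
          (∑ a' ∈ Finset.univ.filter
              (fun a' : Bits m => (hammingDist a a' : ℝ) ≤ γ * m),
            A x y a' ⊗ₖ B x y a')).mulVec ψ)).re = ∑ p, g p := by
    rw [Fintype.sum_prod_type]
    refine sum_congr rfl fun x _ => sum_congr rfl fun y _ => ?_
    simp only [hg]
    rw [sum_comm]
    refine sum_congr rfl fun a _ => ?_
    rw [sum_hammingBall_eq, kronecker_sum_right, sum_mulVec, dotProduct_sum, Complex.re_sum]
  have hN : (0 : ℝ) < 2 ^ (2 * n) / 2 ^ m := by positivity
  obtain ⟨s, hs, hle⟩ := exists_section_sum_le f (2 ^ (2 * n) / 2 ^ m) hN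
    (fun z => by have := hf z; field_simp at this ⊢; linarith) g
  have hgame : ∑ z, g (s z) ≤ R.card * (1 + 1 / √2) ^ m := by
    simp only [hg]
    rw [sum_comm, ← nsmul_eq_mul]
    refine sum_le_card_nsmul _ _ _ fun k _ => ?_
    simp only [hs]
    have hpovm : ∀ {d : ℕ} {X : Bits m → Matrix (Fin d) (Fin d) ℂ}, IsPOVM X →
        IsPOVM fun a : Bits m => X fun i => xor (a i) (k i) := fun {d X} hX =>
      ⟨fun a => hX.1 _, by
        rw [← hX.2]
        exact Fintype.sum_equiv
          (Function.Involutive.toPerm (fun (a : Bits m) i => xor (a i) (k i)) fun a => by simp)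
          _ _ fun a => rfl⟩
    exact sum_game_le ψ hψ _ _ (fun z => hpovm (hA _ _)) fun z => hpovm (hB _ _)
  rw [hsum]
  calc (1 / 2 ^ (2 * n) : ℝ) * ∑ p, g p
      ≤ 1 / 2 ^ (2 * n) * (2 ^ (2 * n) / 2 ^ m * (((2 : ℝ) ^ binEnt γ) ^ m * (1 + 1 / √2) ^ m)) := by
        gcongr
        refine hle.trans ?_
        gcongr
        refine hgame.trans ?_
        gcongr
        exact card_hammingBall_le hγ0 hγ1
    _ = lamGamma γ ^ m := by
        have h : (1 / 2 + 1 / (2 * √2) : ℝ) = (1 + 1 / √2) / 2 := by field_simp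
        rw [lamGamma, h, mul_pow, div_pow]
        field_simp
end
end

section
/- Let n,m ∈ ℕ, ε ∈ (0,1), and fix z ∈ {0,1}^m. Assume 3·ln(2/ε) ≤ 2^{2n−m}. Let f be drawn uniformly at random from the set of all functions {0,1}^n × {0,1}^n → {0,1}^m. Then with probability at least 1 − ε, the function f satisfies |q_f(z) − 2^{−m}| ≤ √(3·ln(2/ε)) · 2^{−n−m/2}. -/
open Finset

noncomputable section

/-- `q_f(z)`: the fraction of input pairs `(x,y)` mapped by `f` to `z`. -/
def qf (n m : ℕ) (f : Bits n × Bits n → Bits m) (z : Bits m) : ℝ :=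
  ((Finset.univ.filter (fun p : Bits n × Bits n => f p = z)).card : ℝ) / 2 ^ (2 * n)

/-- The exponential moment of the number of preimages of `z` under a uniformly random function. -/
lemma sum_exp_mul_card_fiber {α β : Type*} [Fintype α] [DecidableEq α] [Fintype β]
    [DecidableEq β] (z : β) (t : ℝ) :
    ∑ f : α → β, Real.exp (t * #{x | f x = z}) =
      (Fintype.card β + (Real.exp t - 1)) ^ Fintype.card α := by
  have hβ : ∑ b : β, Real.exp (if b = z then t else 0) =
      Fintype.card β + (Real.exp t - 1) := by
    have hb (b : β) : Real.exp (if b = z then t else 0) =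
        1 + if b = z then Real.exp t - 1 else 0 := by
      split_ifs <;> simp
    simp [hb, Finset.sum_add_distrib]
  have hf (f : α → β) : Real.exp (t * #{x | f x = z}) =
      ∏ x, Real.exp (if f x = z then t else 0) := by
    rw [← Real.exp_sum, ← Finset.sum_filter, Finset.sum_const, nsmul_eq_mul, mul_comm]
  simp_rw [hf]
  rw [← Fintype.piFinset_univ,
    Finset.sum_prod_piFinset univ fun (_ : α) b => Real.exp (if b = z then t else 0)]
  simp [hβ]

/-- The Chernoff bound for the number of preimages of `z`, covering the upper tail (`t ≥ 0`) and
the lower tail (`t ≤ 0`). -/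
lemma card_fiber_tail_le {α β : Type*} [Fintype α] [DecidableEq α] [Fintype β]
    [DecidableEq β] (z : β) (t a : ℝ) :
    (#{f : α → β | t * a ≤ t * #{x | f x = z}} : ℝ) ≤
      Real.exp (Fintype.card α / Fintype.card β * (Real.exp t - 1) - t * a) *
        Fintype.card (α → β) := by
  have hM : (1 : ℝ) ≤ Fintype.card β := by
    exact_mod_cast Fintype.card_pos_iff.mpr ⟨z⟩
  have markov : Real.exp (t * a) * #{f : α → β | t * a ≤ t * #{x | f x = z}} ≤
      ∑ f : α → β, Real.exp (t * #{x | f x = z}) := by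
    rw [mul_comm, ← nsmul_eq_mul]
    refine (Finset.card_nsmul_le_sum _ _ _ fun f hf => Real.exp_le_exp.mpr ?_).trans
      (Finset.sum_le_sum_of_subset_of_nonneg (Finset.subset_univ _) fun _ _ _ =>
        (Real.exp_pos _).le)
    exact (Finset.mem_filter.mp hf).2
  have moment : ((Fintype.card β : ℝ) + (Real.exp t - 1)) ^ Fintype.card α ≤
      Real.exp (Fintype.card α / Fintype.card β * (Real.exp t - 1)) *
        Fintype.card (α → β) := by
    have base : (Fintype.card β : ℝ) + (Real.exp t - 1) ≤
        Real.exp ((Real.exp t - 1) / Fintype.card β) * Fintype.card β := by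
      have h1 := mul_le_mul_of_nonneg_right
        (Real.add_one_le_exp ((Real.exp t - 1) / Fintype.card β)) (zero_le_one.trans hM)
      rwa [add_mul, div_mul_cancel₀ _ (by positivity), one_mul, add_comm] at h1
    refine (pow_le_pow_left₀ (by linarith [Real.exp_pos t]) base _).trans_eq ?_
    rw [mul_pow, ← Real.exp_nat_mul, Fintype.card_fun, Nat.cast_pow]
    congr 2
    ring
  rw [sum_exp_mul_card_fiber] at markov
  rw [Real.exp_sub, div_mul_eq_mul_div, le_div_iff₀ (Real.exp_pos _), mul_comm]
  exact markov.trans moment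

lemma exp_neg_le_quadratic {x : ℝ} (hx : 0 ≤ x) : Real.exp (-x) ≤ 1 - x + x ^ 2 / 2 := by
  rw [Real.exp_neg, inv_le_iff_one_le_mul₀ (Real.exp_pos x)]
  have hq : 0 ≤ 1 - x + x ^ 2 / 2 := by nlinarith [sq_nonneg (x - 1)]
  nlinarith [mul_le_mul_of_nonneg_left (Real.quadratic_le_exp_of_nonneg hx) hq,
    sq_nonneg (x ^ 2)]

lemma upper_tail_exponent_le {δ : ℝ} (h0 : 0 ≤ δ) (h1 : δ ≤ 1) :
    δ - Real.log (1 + δ) * (1 + δ) ≤ -(δ ^ 2 / 3) := by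
  have hlog := mul_le_mul_of_nonneg_right (Real.le_log_one_add_of_nonneg h0)
    (by linarith : 0 ≤ 1 + δ)
  have hfrac : δ + δ ^ 2 / 3 ≤ 2 * δ / (δ + 2) * (1 + δ) := by
    rw [div_mul_eq_mul_div, le_div_iff₀ (by linarith)]
    nlinarith [mul_nonneg (sq_nonneg δ) (sub_nonneg.mpr h1)]
  linarith

/-- Two-sided multiplicative Chernoff bound for the number of preimages of `z`. -/
lemma card_fiber_deviation_le {α β : Type*} [Fintype α] [DecidableEq α] [Fintype β]
    [DecidableEq β] (z : β) {δ μ : ℝ} (h0 : 0 ≤ δ) (h1 : δ ≤ 1)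
    (hμ : μ = Fintype.card α / Fintype.card β) :
    (#{f : α → β | δ * μ < |(#{x | f x = z} : ℝ) - μ|} : ℝ) ≤
      2 * Real.exp (-(μ * δ ^ 2 / 3)) * Fintype.card (α → β) := by
  have hμ0 : 0 ≤ μ := hμ ▸ by positivity
  have hup := card_fiber_tail_le (α := α) z (Real.log (1 + δ)) ((1 + δ) * μ)
  have hlow := card_fiber_tail_le (α := α) z (-δ) ((1 - δ) * μ)
  rw [← hμ] at hup hlow
  have hsub : ({f : α → β | δ * μ < |(#{x | f x = z} : ℝ) - μ|} : Finset (α → β)) ⊆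
      ({f : α → β | Real.log (1 + δ) * ((1 + δ) * μ) ≤
        Real.log (1 + δ) * #{x | f x = z}} : Finset (α → β)) ∪
      ({f : α → β | -δ * ((1 - δ) * μ) ≤ -δ * #{x | f x = z}} : Finset (α → β)) := by
    intro f hf
    simp only [mem_union, mem_filter, mem_univ, true_and] at hf ⊢
    rcases lt_abs.mp hf with hf | hf
    · left
      exact mul_le_mul_of_nonneg_left (by linarith) (Real.log_nonneg (by linarith))
    · right
      exact mul_le_mul_of_nonpos_left (by linarith) (by linarith)
  have hcard : (#{f : α → β | δ * μ < |(#{x | f x = z} : ℝ) - μ|} : ℝ) ≤ _ :=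
    Nat.cast_le.mpr ((card_le_card hsub).trans (card_union_le _ _))
  have eup : Real.exp (μ * (Real.exp (Real.log (1 + δ)) - 1) -
      Real.log (1 + δ) * ((1 + δ) * μ)) ≤ Real.exp (-(μ * δ ^ 2 / 3)) := by
    rw [Real.exp_le_exp, Real.exp_log (by linarith)]
    nlinarith [mul_le_mul_of_nonneg_left (upper_tail_exponent_le h0 h1) hμ0]
  have elow : Real.exp (μ * (Real.exp (-δ) - 1) - -δ * ((1 - δ) * μ)) ≤
      Real.exp (-(μ * δ ^ 2 / 3)) := by
    rw [Real.exp_le_exp]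
    nlinarith [mul_le_mul_of_nonneg_left (exp_neg_le_quadratic h0) hμ0,
      mul_nonneg hμ0 (sq_nonneg δ)]
  have hC : (0 : ℝ) ≤ Fintype.card (α → β) := by positivity
  push_cast at hcard
  linarith [mul_le_mul_of_nonneg_right eup hC, mul_le_mul_of_nonneg_right elow hC]

/-- for a uniformly random function `f : {0,1}ⁿ × {0,1}ⁿ → {0,1}^m` and a
fixed `z`, with probability at least `1 - ε` one has
`|q_f(z) - 2^{-m}| ≤ √(3 ln(2/ε)) · 2^{-n-m/2}`. -/
theorem stmt1 (n m : ℕ) (ε : ℝ) (hε0 : 0 < ε) (hε1 : ε < 1) (z : Bits m)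
    (h : 3 * Real.log (2 / ε) ≤ (2 : ℝ) ^ ((2 * n : ℝ) - m)) :
    (1 - ε) * (Fintype.card (Bits n × Bits n → Bits m) : ℝ) ≤
      (({f : Bits n × Bits n → Bits m |
          |qf n m f z - (2 : ℝ) ^ (-(m : ℝ))| ≤
            Real.sqrt (3 * Real.log (2 / ε)) * (2 : ℝ) ^ (-(n : ℝ) - m / 2)}.ncard : ℝ)) := by
  have hL : 0 ≤ 3 * Real.log (2 / ε) :=
    mul_nonneg zero_le_three (Real.log_nonneg (by rw [le_div_iff₀ hε0]; linarith))
  set μ : ℝ := (2 : ℝ) ^ ((2 * n : ℝ) - m) with hμ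
  have hμ0 : 0 < μ := by positivity
  have hpow : (2 : ℝ) ^ (2 * n) = (2 : ℝ) ^ (2 * n : ℝ) := by
    rw [← Real.rpow_natCast]; push_cast; rfl
  set δ : ℝ := Real.sqrt (3 * Real.log (2 / ε)) * (2 : ℝ) ^ ((m : ℝ) / 2 - n) with hδ
  have hδ0 : 0 ≤ δ := by positivity
  have hδμ : μ * δ ^ 2 = 3 * Real.log (2 / ε) := by
    rw [hδ, mul_pow, Real.sq_sqrt hL, mul_left_comm, hμ, ← Real.rpow_mul_natCast zero_le_two,
      ← Real.rpow_add two_pos]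
    have : (2 * n : ℝ) - m + ((m : ℝ) / 2 - n) * (2 : ℕ) = 0 := by push_cast; ring
    rw [this, Real.rpow_zero, mul_one]
  have hδ1 : δ ≤ 1 := by
    have : μ * δ ^ 2 ≤ μ * 1 := by rw [hδμ, mul_one]; exact h
    exact (sq_le_one_iff₀ hδ0).mp (le_of_mul_le_mul_left this hμ0)
  have hμcard : μ = Fintype.card (Bits n × Bits n) / Fintype.card (Bits m) := by
    rw [hμ, Real.rpow_sub two_pos, ← hpow, Real.rpow_natCast]
    simp [two_mul, pow_add]
  have key := card_fiber_deviation_le (α := Bits n × Bits n) z hδ0 hδ1 hμcard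
  have hexp : 2 * Real.exp (-(μ * δ ^ 2 / 3)) = ε := by
    rw [hδμ, mul_div_cancel_left₀ _ three_ne_zero, Real.exp_neg, Real.exp_log (by positivity)]
    field_simp
  rw [hexp] at key
  have hgood : {f : Bits n × Bits n → Bits m |
      |qf n m f z - (2 : ℝ) ^ (-(m : ℝ))| ≤
        Real.sqrt (3 * Real.log (2 / ε)) * (2 : ℝ) ^ (-(n : ℝ) - m / 2)} =
      ({f | ¬ δ * μ < |(#{x | f x = z} : ℝ) - μ|} : Finset (Bits n × Bits n → Bits m)) := by
    ext f
    have hN : (0 : ℝ) < (2 : ℝ) ^ (2 * n) := by positivity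
    have hq : qf n m f z - (2 : ℝ) ^ (-(m : ℝ)) =
        ((#{x | f x = z} : ℝ) - μ) / 2 ^ (2 * n) := by
      rw [qf, sub_div, hμ, hpow, ← Real.rpow_sub two_pos]
      ring_nf
    have hr : Real.sqrt (3 * Real.log (2 / ε)) * (2 : ℝ) ^ (-(n : ℝ) - m / 2) =
        δ * μ / 2 ^ (2 * n) := by
      rw [hδ, hμ, hpow, mul_div_assoc, mul_assoc, ← Real.rpow_sub two_pos,
        ← Real.rpow_add two_pos]
      ring_nf
    simp only [Set.mem_ofPred_eq, coe_filter, mem_univ, true_and, not_lt]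
    rw [hq, hr, abs_div, abs_of_pos hN, div_le_div_iff_of_pos_right hN]
  rw [hgood, Set.ncard_coe_finset]
  have hsplit := Finset.card_filter_add_card_filter_not (s := univ)
    fun f : Bits n × Bits n → Bits m => δ * μ < |(#{x | f x = z} : ℝ) - μ|
  rw [Finset.card_univ] at hsplit
  have hsplit' := congrArg (Nat.cast : ℕ → ℝ) hsplit
  rw [Nat.cast_add] at hsplit'
  linarith
end
end
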